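/- Exact splitting formula: Let V : ℝ^d → ℝ be continuous, let μ_0 be a probability measure on ℝ^d with bounded density supported in a compact set, and let ζ = w*μ_0 + V/2 − (E[μ_0] + D(μ_0,μ_0))/2. Let x_1,…,x_n ∈ ℝ^d be pairwise distinct, set x_i' = n^{1/d} x_i and h_n'(z) = Σ_{i=1}^n w(z − x_i') − ∫_{ℝ^d} w(z − y) μ_0(n^{−1/d} y) dy. Then the limit W(∇h_n', 1_{ℝ^d}) := lim_{η→0} ( ∫_{ℝ^d ∖ ⋃_{i=1}^n B(x_i', η)} |∇h_n'|² − n c_d w(η) ) exists in ℝ, and H_n(x_1,…,x_n) = n² E[μ_0] + 2n Σ_{i=1}^n ζ(x_i) − (1/2)(n log n)·1_{d=2} + n^{1−2/d} c_d^{−1} W(∇h_n', 1_{ℝ^d}). -/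

import Mathlib

open MeasureTheory Metric Real Filter
open scoped Topology ENNReal BigOperators

noncomputable section

/-- Euclidean space `ℝ^d`. -/
abbrev Euc (d : ℕ) := EuclideanSpace ℝ (Fin d)

/-- The Coulomb kernel `w` : `|x|^{2-d}` for `d ≥ 3`, `-log |x|` for `d = 2`. -/
def ck (d : ℕ) (x : Euc d) : ℝ :=
  if d = 2 then -Real.log ‖x‖ else ‖x‖ ^ ((2 : ℝ) - d)

/-- The Coulomb kernel as a function of the radius. -/
def ckr (d : ℕ) (r : ℝ) : ℝ :=
  if d = 2 then -Real.log r else r ^ ((2 : ℝ) - d)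

/-- The constant `c_d`: `2π` for `d = 2` and `(d−2)|S^{d−1}|` for `d ≥ 3`
(using `|S^{d-1}| = d · |B(0,1)|`). -/
def cConst (d : ℕ) : ℝ :=
  if d = 2 then 2 * π
  else ((d : ℝ) - 2) * d * (volume (ball (0 : Euc d) 1)).toReal

/-- The Coulomb interaction `D(f,g) = ∬ w(x-y) f(x) g(y) dx dy` of two densities. -/
def coulombPair (d : ℕ) (f g : Euc d → ℝ) : ℝ :=
  ∫ z : Euc d × Euc d, ck d (z.1 - z.2) * f z.1 * g z.2

/-- The Hamiltonian `H_n(x) = Σ_{i≠j} w(x_i − x_j) + n Σ_i V(x_i)`. -/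
def coulombHam (d : ℕ) (V : Euc d → ℝ) (n : ℕ) (x : Fin n → Euc d) : ℝ :=
  (∑ i : Fin n, ∑ j : Fin n, if i ≠ j then ck d (x i - x j) else 0)
    + (n : ℝ) * ∑ i, V (x i)

/-- The mean-field energy `E[μ] = D(μ,μ) + ∫ V dμ` of a density `μ`. -/
def mfEnergy (d : ℕ) (V : Euc d → ℝ) (μ : Euc d → ℝ) : ℝ :=
  coulombPair d μ μ + ∫ x, V x * μ x

/-- The effective potential `ζ = w*μ₀ + V/2 − (E[μ₀] + D(μ₀,μ₀))/2`. -/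
def zetaFn (d : ℕ) (V : Euc d → ℝ) (μ₀ : Euc d → ℝ) (x : Euc d) : ℝ :=
  (∫ y, ck d (x - y) * μ₀ y) + V x / 2
    - (mfEnergy d V μ₀ + coulombPair d μ₀ μ₀) / 2

/-- The blown-up potential `h_n'(z) = Σ_i w(z − x_i') − ∫ w(z − y) μ₀(n^{−1/d} y) dy`,
where `x_i' = n^{1/d} x_i`. -/
def blownUpPotential (d : ℕ) (μ₀ : Euc d → ℝ) (n : ℕ) (x : Fin n → Euc d) (z : Euc d) : ℝ :=
  (∑ i, ck d (z - ((n : ℝ) ^ ((d : ℝ)⁻¹)) • x i))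
    - ∫ y, ck d (z - y) * μ₀ (((n : ℝ) ^ (-(d : ℝ)⁻¹)) • y)

/-- The normalising factor of `∇w`. -/
def kapC (d : ℕ) : ℝ := if d = 2 then 1 else (d : ℝ) - 2

lemma kapC_pos {d : ℕ} (hd : 2 ≤ d) : 0 < kapC d := by
  unfold kapC
  split_ifs with h
  · norm_num
  · have : (3 : ℝ) ≤ d := by exact_mod_cast (by omega : 3 ≤ d)
    linarith

lemma cConst_eq {d : ℕ} (hd : 2 ≤ d) :
    cConst d = kapC d * (d * (volume (ball (0 : Euc d) 1)).toReal) := by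
  unfold cConst kapC
  split_ifs with h
  · subst h
    rw [EuclideanSpace.volume_ball_fin_two]
    simp [ENNReal.toReal_ofReal Real.pi_pos.le]
  · ring

lemma cConst_pos {d : ℕ} (hd : 2 ≤ d) : 0 < cConst d := by
  rw [cConst_eq hd]
  have h1 := kapC_pos hd
  have h2 : 0 < (volume (ball (0 : Euc d) 1)).toReal :=
    ENNReal.toReal_pos (measure_ball_pos _ _ one_pos).ne' measure_ball_lt_top.ne
  have : (0 : ℝ) < d := by positivity
  positivity

/-- The gradient of the Coulomb kernel. -/
def gradK (d : ℕ) (z : Euc d) : Euc d := (-(kapC d * (‖z‖ ^ d)⁻¹)) • z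

/-- The gradient of the Coulomb kernel, set to zero in a ball of radius `η`. -/
def gradT (d : ℕ) (η : ℝ) (z : Euc d) : Euc d := if η ≤ ‖z‖ then gradK d z else 0

/-- The Coulomb kernel truncated at radius `η`. -/
def ckT (d : ℕ) (η : ℝ) (z : Euc d) : ℝ := ckr d (max ‖z‖ η)

/-- An integrable radial majorant. -/
def majK (d : ℕ) (z : Euc d) : ℝ := (‖z‖ ^ (d - 1))⁻¹ * ((1 + ‖z‖) ^ d)⁻¹

lemma ck_eq_ckr (d : ℕ) (z : Euc d) : ck d z = ckr d ‖z‖ := rfl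

lemma ckr_eq_of_ne {d : ℕ} (hd : 2 ≤ d) (h2 : d ≠ 2) (r : ℝ) :
    ckr d r = (r ^ (d - 2))⁻¹ := by
  unfold ckr
  rw [if_neg h2]
  have : (2 : ℝ) - d = -((d - 2 : ℕ) : ℝ) := by push_cast [Nat.cast_sub hd]; ring
  rw [this, Real.rpow_neg_natCast, zpow_neg, zpow_natCast]

lemma hasDerivAt_ckr {d : ℕ} (hd : 2 ≤ d) {r : ℝ} (hr : 0 < r) :
    HasDerivAt (ckr d) (-(kapC d * (r ^ (d - 1))⁻¹)) r := by
  by_cases h2 : d = 2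
  · subst h2
    have : ckr 2 = fun r => -Real.log r := by ext; simp [ckr]
    rw [this]
    exact (Real.hasDerivAt_log hr.ne').fun_neg.congr_deriv (by simp [kapC])
  · have : ckr d = fun r => (r ^ (d - 2))⁻¹ := funext (ckr_eq_of_ne hd h2)
    rw [this]
    obtain ⟨m, rfl⟩ : ∃ m, d = m + 3 := ⟨d - 3, by omega⟩
    refine ((hasDerivAt_pow (m + 3 - 2) r).fun_inv (by positivity)).congr_deriv ?_
    simp only [kapC, if_neg h2, show m + 3 - 1 = m + 2 by omega, show m + 3 - 2 = m + 1 by omega,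
      show m + 1 - 1 = m by omega]
    push_cast
    field_simp
    ring

lemma norm_gradK {d : ℕ} (hd : 2 ≤ d) (z : Euc d) :
    ‖gradK d z‖ = kapC d * (‖z‖ ^ (d - 1))⁻¹ := by
  have := kapC_pos hd
  unfold gradK
  rw [norm_smul, norm_neg, Real.norm_of_nonneg (by positivity)]
  rcases eq_or_ne z 0 with rfl | hz
  · simp [show d - 1 ≠ 0 by omega]
  · have : 0 < ‖z‖ := norm_pos_iff.2 hz
    obtain ⟨m, rfl⟩ : ∃ m, d = m + 1 := ⟨d - 1, by omega⟩
    simp only [Nat.add_sub_cancel]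
    field_simp
    ring

lemma hasFDerivAt_norm_of_ne_zero {d : ℕ} {z : Euc d} (hz : z ≠ 0) :
    HasFDerivAt (fun z : Euc d => ‖z‖) (‖z‖⁻¹ • innerSL ℝ z) z := by
  have h1 : HasFDerivAt (fun z : Euc d => ‖z‖ ^ 2) (2 • innerSL ℝ z) z := by
    simpa using (hasStrictFDerivAt_norm_sq z).hasFDerivAt
  have hp : 0 < ‖z‖ := norm_pos_iff.2 hz
  have h2 := h1.sqrt (by positivity)
  have e : (fun z : Euc d => ‖z‖) = fun z => √(‖z‖ ^ 2) := by
    ext; simp [Real.sqrt_sq]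
  rw [e]
  refine h2.congr_fderiv ?_
  rw [Real.sqrt_sq hp.le]
  ext v
  simp
  field_simp

lemma hasGradientAt_ck {d : ℕ} (hd : 2 ≤ d) {z : Euc d} (hz : z ≠ 0) :
    HasGradientAt (ck d) (gradK d z) z := by
  have hp : 0 < ‖z‖ := norm_pos_iff.2 hz
  have h := (hasDerivAt_ckr hd hp).comp_hasFDerivAt z (hasFDerivAt_norm_of_ne_zero hz)
  rw [hasGradientAt_iff_hasFDerivAt]
  refine h.congr_fderiv ?_
  ext v
  obtain ⟨m, rfl⟩ : ∃ m, d = m + 1 := ⟨d - 1, by omega⟩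
  simp only [gradK, Nat.add_sub_cancel, map_smul, smul_apply,
    InnerProductSpace.toDual_apply_apply, innerSL_apply_apply, smul_eq_mul]
  field_simp
  ring

lemma hasGradientAt_ckT {d : ℕ} (hd : 2 ≤ d) {η : ℝ} (hη : 0 < η) {z : Euc d} (hz : ‖z‖ ≠ η) :
    HasGradientAt (ckT d η) (gradT d η z) z := by
  rcases hz.lt_or_gt with h | h
  · have e : ckT d η =ᶠ[𝓝 z] fun _ => ckr d η := by
      filter_upwards [continuous_norm.continuousAt.eventually_lt continuousAt_const h] with y hy
      simp [ckT, max_eq_right hy.le]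
    rw [gradT, if_neg (not_le.2 h)]
    exact (hasGradientAt_const z _).congr_of_eventuallyEq e
  · have e : ckT d η =ᶠ[𝓝 z] ck d := by
      filter_upwards [continuousAt_const.eventually_lt continuous_norm.continuousAt h] with y hy
      simp [ckT, max_eq_left (le_of_lt hy), ck_eq_ckr]
    rw [gradT, if_pos h.le]
    exact (hasGradientAt_ck hd (norm_pos_iff.1 (hη.trans h))).congr_of_eventuallyEq e

lemma abs_ckr_sub_le {d : ℕ} (hd : 2 ≤ d) {m a b : ℝ} (hm : 0 < m) (ha : m ≤ a) (hb : m ≤ b) :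
    |ckr d a - ckr d b| ≤ kapC d * (m ^ (d - 1))⁻¹ * |a - b| := by
  have hk := kapC_pos hd
  have := (convex_Ici m).norm_image_sub_le_of_norm_hasDerivWithin_le (f := ckr d)
    (f' := fun r => -(kapC d * (r ^ (d - 1))⁻¹)) (C := kapC d * (m ^ (d - 1))⁻¹) (x := b) (y := a)
    (fun r hr => (hasDerivAt_ckr hd (hm.trans_le hr)).hasDerivWithinAt)
    (fun r hr => by
      have h0 : 0 < r := hm.trans_le hr
      rw [norm_neg, Real.norm_of_nonneg (by positivity)]
      gcongr
      exact hr) hb ha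
  simpa [Real.norm_eq_abs] using this

lemma abs_ckT_sub_le {d : ℕ} (hd : 2 ≤ d) {η : ℝ} (hη : 0 < η) (u v : Euc d) :
    |ckT d η u - ckT d η v| ≤ kapC d * (η ^ (d - 1))⁻¹ * ‖u - v‖ := by
  have hk := kapC_pos hd
  refine (abs_ckr_sub_le hd hη (le_max_right _ _) (le_max_right _ _)).trans ?_
  gcongr
  refine (abs_max_sub_max_le_abs _ _ _).trans (abs_norm_sub_norm_le u v)

lemma continuous_ckT {d : ℕ} (hd : 2 ≤ d) {η : ℝ} (hη : 0 < η) : Continuous (ckT d η) := by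
  have hk := kapC_pos hd
  have : LipschitzWith (Real.toNNReal (kapC d * (η ^ (d - 1))⁻¹)) (ckT d η) :=
    LipschitzWith.of_dist_le_mul fun u v => by
      rw [Real.coe_toNNReal _ (by positivity), Real.dist_eq, dist_eq_norm]
      exact abs_ckT_sub_le hd hη u v
  exact this.continuous

lemma abs_ckr_le {d : ℕ} (hd : 2 ≤ d) {r : ℝ} (hr : 0 ≤ r) :
    |ckr d r| ≤ (r ^ (d - 1))⁻¹ * (1 + r) ^ 2 := by
  rcases hr.eq_or_lt with rfl | hr
  · by_cases h2 : d = 2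
    · subst h2; simp [ckr]
    · rw [ckr_eq_of_ne hd h2]; simp [show d - 1 ≠ 0 by omega, show d - 2 ≠ 0 by omega]
  by_cases h2 : d = 2
  · subst h2
    simp only [ckr, if_true, abs_neg]
    norm_num
    have e : r⁻¹ * (1 + r) ^ 2 = r⁻¹ + 2 + r := by field_simp; ring
    have h1 := Real.log_le_sub_one_of_pos hr
    have h2 := Real.log_le_sub_one_of_pos (inv_pos.2 hr)
    have h3 := inv_pos.2 hr
    rw [Real.log_inv] at h2
    rw [e, abs_le]
    constructor <;> linarith
  · rw [ckr_eq_of_ne hd h2, abs_of_pos (by positivity)]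
    obtain ⟨m, rfl⟩ : ∃ m, d = m + 2 := ⟨d - 2, by omega⟩
    simp only [show m + 2 - 1 = m + 1 by omega, Nat.add_sub_cancel]
    rw [inv_mul_eq_div, le_div_iff₀ (by positivity), inv_mul_eq_div, div_le_iff₀ (by positivity),
      pow_succ, mul_comm]
    gcongr
    nlinarith

lemma measurable_gradK (d : ℕ) : Measurable (gradK d) := by
  unfold gradK; fun_prop

lemma measurable_gradT (d : ℕ) (η : ℝ) : Measurable (gradT d η) :=
  Measurable.ite (measurableSet_le measurable_const measurable_norm) (measurable_gradK d)
    measurable_const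

lemma measurable_ck (d : ℕ) : Measurable (ck d) := by
  unfold ck
  split_ifs <;> fun_prop

lemma majK_nonneg (d : ℕ) (z : Euc d) : 0 ≤ majK d z := by unfold majK; positivity

lemma integrable_majK {d : ℕ} (hd : 2 ≤ d) : Integrable (majK d) := by
  have : Nontrivial (Euc d) := by
    have : Nonempty (Fin d) := ⟨⟨0, by omega⟩⟩
    infer_instance
  have := (integrable_fun_norm_addHaar (volume : Measure (Euc d))
    (f := fun r : ℝ => (r ^ (d - 1))⁻¹ * ((1 + r) ^ d)⁻¹)).2 ?_
  · exact this
  · simp only [finrank_euclideanSpace_fin, smul_eq_mul]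
    have h1 : IntegrableOn (fun r : ℝ => (1 + ‖r‖) ^ (-(d : ℝ))) (Set.Ioi 0) :=
      (integrable_one_add_norm (by simp; exact_mod_cast hd)).integrableOn
    refine h1.congr_fun (fun r hr => ?_) measurableSet_Ioi
    have hr : 0 < r := hr
    simp only [Real.norm_of_nonneg hr.le]
    rw [Real.rpow_neg (by positivity), Real.rpow_natCast]
    field_simp

/-- A bounded measurable density supported in a ball of radius `R ≥ 1`. -/
structure BddDensity {d : ℕ} (μ : Euc d → ℝ) (M R : ℝ) : Prop where
  measurable : Measurable μ
  abs_le : ∀ y, |μ y| ≤ M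
  eq_zero : ∀ y, R < ‖y‖ → μ y = 0
  one_le : 1 ≤ R

/-- The Coulomb potential of a density. -/
def pot (d : ℕ) (μ : Euc d → ℝ) (z : Euc d) : ℝ := ∫ y, ck d (z - y) * μ y

/-- The potential of a density for the truncated kernel. -/
def potT (d : ℕ) (η : ℝ) (μ : Euc d → ℝ) (z : Euc d) : ℝ := ∫ y, ckT d η (z - y) * μ y

/-- The Coulomb field of a density. -/
def field (d : ℕ) (μ : Euc d → ℝ) (z : Euc d) : Euc d := ∫ y, μ y • gradK d (z - y)

/-- The field of a density for the truncated kernel. -/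
def fieldT (d : ℕ) (η : ℝ) (μ : Euc d → ℝ) (z : Euc d) : Euc d :=
  ∫ y, μ y • gradT d η (z - y)

lemma inv_pow_le_majK_of_le_one {d : ℕ} {u : Euc d} (h : ‖u‖ ≤ 1) :
    (‖u‖ ^ (d - 1))⁻¹ ≤ 2 ^ d * majK d u := by
  have h0 := norm_nonneg u
  unfold majK
  have h2 : (1 : ℝ) ≤ 2 ^ d * ((1 + ‖u‖) ^ d)⁻¹ := by
    rw [← div_eq_mul_inv, le_div_iff₀ (by positivity), one_mul]
    gcongr
    linarith
  calc (‖u‖ ^ (d - 1))⁻¹ = (‖u‖ ^ (d - 1))⁻¹ * 1 := (mul_one _).symm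
    _ ≤ (‖u‖ ^ (d - 1))⁻¹ * (2 ^ d * ((1 + ‖u‖) ^ d)⁻¹) := by gcongr
    _ = _ := by ring

lemma inv_pow_le_majK {d : ℕ} (u : Euc d) :
    (‖u‖ ^ (d - 1))⁻¹ ≤ 2 ^ d * majK d u + 1 := by
  have hm := majK_nonneg d u
  rcases le_or_gt 1 ‖u‖ with h | h
  · have : (‖u‖ ^ (d - 1))⁻¹ ≤ 1 := inv_le_one_of_one_le₀ (one_le_pow₀ h)
    have : 0 ≤ 2 ^ d * majK d u := by positivity
    linarith
  · linarith [inv_pow_le_majK_of_le_one h.le]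

lemma tendsto_volume_ball {d : ℕ} (hd : 2 ≤ d) (p : Euc d) :
    Tendsto (fun η => volume (ball p η)) (𝓝[>] 0) (𝓝 0) := by
  have h1 : Tendsto (fun η : ℝ => ENNReal.ofReal (η ^ d) * volume (ball (0 : Euc d) 1)) (𝓝[>] 0)
      (𝓝 (ENNReal.ofReal (0 ^ d) * volume (ball (0 : Euc d) 1))) := by
    refine ENNReal.Tendsto.mul_const (ENNReal.tendsto_ofReal ?_)
      (Or.inr measure_ball_lt_top.ne)
    exact ((continuous_pow d).tendsto 0).mono_left nhdsWithin_le_nhds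
  rw [zero_pow (by omega), ENNReal.ofReal_zero, zero_mul] at h1
  refine h1.congr' ?_
  filter_upwards [self_mem_nhdsWithin] with η hη
  rw [Measure.addHaar_ball_of_pos _ _ hη, finrank_euclideanSpace_fin]

lemma norm_gradT_le {d : ℕ} (hd : 2 ≤ d) (η : ℝ) (z : Euc d) :
    ‖gradT d η z‖ ≤ kapC d * (‖z‖ ^ (d - 1))⁻¹ := by
  have := kapC_pos hd
  unfold gradT
  split_ifs
  · exact (norm_gradK hd z).le
  · rw [norm_zero]; positivity

lemma norm_gradT_le_of_pos {d : ℕ} (hd : 2 ≤ d) {η : ℝ} (hη : 0 < η) (z : Euc d) :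
    ‖gradT d η z‖ ≤ kapC d * (η ^ (d - 1))⁻¹ := by
  have := kapC_pos hd
  unfold gradT
  split_ifs with h
  · rw [norm_gradK hd z]
    gcongr
  · rw [norm_zero]; positivity

lemma abs_ckT_le {d : ℕ} (hd : 2 ≤ d) {η : ℝ} (hη1 : η ≤ 1) {z : Euc d} (hz : z ≠ 0) :
    |ckT d η z| ≤ (‖z‖ ^ (d - 1))⁻¹ * (2 + ‖z‖) ^ 2 := by
  have hp : 0 < ‖z‖ := norm_pos_iff.2 hz
  refine (abs_ckr_le hd (hp.le.trans (le_max_left _ _))).trans ?_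
  have : max ‖z‖ η ≤ 1 + ‖z‖ := max_le (by linarith) (by linarith)
  have h2 : ‖z‖ ≤ max ‖z‖ η := le_max_left _ _
  have h3 : 1 + max ‖z‖ η ≤ 2 + ‖z‖ := by linarith
  gcongr

namespace BddDensity

variable {d : ℕ} {μ : Euc d → ℝ} {M R : ℝ}

lemma nonneg (h : BddDensity μ M R) : 0 ≤ M := (abs_nonneg _).trans (h.abs_le 0)

lemma integrable (h : BddDensity μ M R) : Integrable μ := by
  have h1 : IntegrableOn μ (closedBall 0 R) :=
    Measure.integrableOn_of_bounded (M := M) measure_closedBall_lt_top.ne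
      h.measurable.aestronglyMeasurable (Eventually.of_forall fun y => h.abs_le y)
  refine (integrableOn_iff_integrable_of_support_subset fun y hy => ?_).1 h1
  by_contra hc
  exact hy (h.eq_zero y (by simpa using hc))

lemma integrable_majK_mul (hd : 2 ≤ d) (h : BddDensity μ M R) (z : Euc d) :
    Integrable fun y => majK d (z - y) * |μ y| :=
  ((integrable_majK hd).comp_sub_left z).mul_bdd (c := M)
    h.measurable.abs.aestronglyMeasurable
    (Eventually.of_forall fun y => by simpa using h.abs_le y)

lemma integrable_sing_mul (hd : 2 ≤ d) (h : BddDensity μ M R) (z : Euc d) :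
    Integrable fun y => (‖z - y‖ ^ (d - 1))⁻¹ * |μ y| := by
  refine (((h.integrable_majK_mul hd z).const_mul (2 ^ d)).add h.integrable.abs).mono'
    (by have := h.measurable; fun_prop) (Eventually.of_forall fun y => ?_)
  rw [Real.norm_of_nonneg (by positivity)]
  have := mul_le_mul_of_nonneg_right (inv_pow_le_majK (z - y)) (abs_nonneg (μ y))
  simp only [Pi.add_apply]
  linarith

lemma abs_kernel_mul_le (h : BddDensity μ M R) {z y : Euc d} {a : ℝ}
    (ha : |a| ≤ (‖z - y‖ ^ (d - 1))⁻¹ * (2 + ‖z - y‖) ^ 2) :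
    |a * μ y| ≤ (2 + ‖z‖ + R) ^ 2 * ((‖z - y‖ ^ (d - 1))⁻¹ * |μ y|) := by
  rcases lt_or_ge R ‖y‖ with hy | hy
  · simp [h.eq_zero y hy]
  · have h1 : ‖z - y‖ ≤ ‖z‖ + R := (norm_sub_le _ _).trans (by linarith)
    have h2 : 2 + ‖z - y‖ ≤ 2 + ‖z‖ + R := by linarith
    have h3 : (2 + ‖z - y‖) ^ 2 ≤ (2 + ‖z‖ + R) ^ 2 := by gcongr
    rw [abs_mul]
    calc |a| * |μ y| ≤ ((‖z - y‖ ^ (d - 1))⁻¹ * (2 + ‖z‖ + R) ^ 2) * |μ y| := by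
          gcongr
          exact ha.trans (by gcongr)
      _ = _ := by ring

lemma integrable_ck_mul (hd : 2 ≤ d) (h : BddDensity μ M R) (z : Euc d) :
    Integrable fun y => ck d (z - y) * μ y := by
  refine ((h.integrable_sing_mul hd z).const_mul ((2 + ‖z‖ + R) ^ 2)).mono' ?_
    (Eventually.of_forall fun y => h.abs_kernel_mul_le ?_)
  · exact (((measurable_ck d).comp (by fun_prop)).mul h.measurable).aestronglyMeasurable
  · refine (abs_ckr_le hd (norm_nonneg _)).trans ?_
    gcongr
    norm_num

lemma tendsto_potT (hd : 2 ≤ d) (h : BddDensity μ M R) (z : Euc d) :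
    Tendsto (fun η => potT d η μ z) (𝓝[>] 0) (𝓝 (pot d μ z)) := by
  have : Nonempty (Fin d) := ⟨⟨0, by omega⟩⟩
  have hne : ∀ᵐ y : Euc d, z - y ≠ 0 := by
    filter_upwards [(volume : Measure (Euc d)).ae_ne z] with y hy
    exact sub_ne_zero.2 hy.symm
  refine tendsto_integral_filter_of_dominated_convergence
    (fun y => (2 + ‖z‖ + R) ^ 2 * ((‖z - y‖ ^ (d - 1))⁻¹ * |μ y|)) ?_ ?_
    ((h.integrable_sing_mul hd z).const_mul _) ?_
  · filter_upwards [self_mem_nhdsWithin] with η hη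
    exact (((continuous_ckT hd hη).measurable.comp (by fun_prop)).mul
      h.measurable).aestronglyMeasurable
  · filter_upwards [nhdsWithin_le_nhds (Iio_mem_nhds one_pos)] with η hη
    filter_upwards [hne] with y hy
    exact h.abs_kernel_mul_le (abs_ckT_le hd (le_of_lt hη) hy)
  · filter_upwards [hne] with y hy
    refine tendsto_const_nhds.congr' ?_
    filter_upwards [nhdsWithin_le_nhds (Iio_mem_nhds (norm_pos_iff.2 hy))] with η hη
    rw [ckT, max_eq_left (le_of_lt hη), ck_eq_ckr]

lemma integrable_smul_gradT (hd : 2 ≤ d) (h : BddDensity μ M R) (η : ℝ) (z : Euc d) :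
    Integrable fun y => μ y • gradT d η (z - y) := by
  refine ((h.integrable_sing_mul hd z).const_mul (kapC d)).mono' ?_
    (Eventually.of_forall fun y => ?_)
  · exact (h.measurable.smul ((measurable_gradT d η).comp (by fun_prop))).aestronglyMeasurable
  · rw [norm_smul, Real.norm_eq_abs, mul_comm, ← mul_assoc]
    gcongr
    exact norm_gradT_le hd η _

lemma integrable_smul_gradK (hd : 2 ≤ d) (h : BddDensity μ M R) (z : Euc d) :
    Integrable fun y => μ y • gradK d (z - y) := by
  refine ((h.integrable_sing_mul hd z).const_mul (kapC d)).mono' ?_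
    (Eventually.of_forall fun y => ?_)
  · exact (h.measurable.smul ((measurable_gradK d).comp (by fun_prop))).aestronglyMeasurable
  · rw [norm_smul, Real.norm_eq_abs, norm_gradK hd]
    exact le_of_eq (by ring)

lemma hasFDerivAt_potT (hd : 2 ≤ d) (h : BddDensity μ M R) {η : ℝ} (hη : 0 < η) (z : Euc d) :
    HasFDerivAt (potT d η μ) (InnerProductSpace.toDual ℝ (Euc d) (fieldT d η μ z)) z := by
  have : Nonempty (Fin d) := ⟨⟨0, by omega⟩⟩
  have hk := kapC_pos hd
  have hmeas : ∀ z : Euc d, AEStronglyMeasurable (fun y => ckT d η (z - y) * μ y) volume :=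
    fun z => (((continuous_ckT hd hη).measurable.comp (by fun_prop)).mul
      h.measurable).aestronglyMeasurable
  set L := kapC d * (η ^ (d - 1))⁻¹ with hL
  have hL0 : 0 ≤ L := by positivity
  have key := hasFDerivAt_integral_of_dominated_loc_of_lip (𝕜 := ℝ) (μ := volume)
    (F := fun z y => ckT d η (z - y) * μ y) (x₀ := z) (s := Set.univ)
    (F' := fun y => InnerProductSpace.toDual ℝ (Euc d) (μ y • gradT d η (z - y)))
    (bound := fun y => L * |μ y|) Filter.univ_mem (Eventually.of_forall hmeas) ?_ ?_ ?_
    (h.integrable.abs.const_mul L) ?_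
  · refine key.2.congr_fderiv ?_
    ext v
    rw [ContinuousLinearMap.integral_apply key.1]
    simp only [InnerProductSpace.toDual_apply_apply, fieldT]
    rw [real_inner_comm, ← integral_inner (h.integrable_smul_gradT hd η z)]
    simp only [real_inner_comm]
  · refine ((h.integrable.abs.const_mul (L * (‖z‖ + R) + |ckT d η 0|))).mono' (hmeas z)
      (Eventually.of_forall fun y => ?_)
    rw [norm_mul, Real.norm_eq_abs, Real.norm_eq_abs]
    rcases lt_or_ge R ‖y‖ with hy | hy
    · simp [h.eq_zero y hy]
    · gcongr
      have h1 := abs_ckT_sub_le hd hη (z - y) 0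
      have h2 : ‖z - y‖ ≤ ‖z‖ + R := (norm_sub_le _ _).trans (by linarith)
      have h3 := abs_sub_abs_le_abs_sub (ckT d η (z - y)) (ckT d η 0)
      have h4 := mul_le_mul_of_nonneg_left h2 hL0
      rw [sub_zero] at h1
      linarith
  · exact (LinearIsometryEquiv.continuous _).comp_aestronglyMeasurable
      (h.integrable_smul_gradT hd η z).aestronglyMeasurable
  · refine Eventually.of_forall fun y => LipschitzOnWith.of_dist_le_mul fun u _ v _ => ?_
    rw [Real.coe_nnabs, abs_of_nonneg (by positivity), Real.dist_eq, dist_eq_norm, ← sub_mul,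
      abs_mul]
    have := abs_ckT_sub_le hd hη (u - y) (v - y)
    rw [sub_sub_sub_cancel_right] at this
    calc _ ≤ (L * ‖u - v‖) * |μ y| := by gcongr
      _ = _ := by ring
  · have hs : ∀ᵐ y : Euc d, y ∉ sphere z η := by
      exact measure_eq_zero_iff_ae_notMem.1 (Measure.addHaar_sphere _ z η)
    filter_upwards [hs] with y hy
    have hy' : ‖z - y‖ ≠ η := by
      rw [mem_sphere_iff_norm, norm_sub_rev] at hy; exact hy
    have h1 := (hasGradientAt_ckT hd hη hy').hasFDerivAt
    have h2 := (h1.comp z ((hasFDerivAt_id z).sub_const y)).mul_const (μ y)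
    refine h2.congr_fderiv ?_
    ext v
    simp

lemma norm_field_sub_fieldT_le (hd : 2 ≤ d) (h : BddDensity μ M R) {η : ℝ} (hη1 : η ≤ 1)
    (z : Euc d) :
    ‖field d μ z - fieldT d η μ z‖ ≤ kapC d * M * 2 ^ d * ∫ u in ball 0 η, majK d u := by
  have hk := kapC_pos hd
  have hM := h.nonneg
  have e : ∫ u in ball 0 η, majK d u = ∫ y, (ball 0 η).indicator (majK d) (z - y) := by
    rw [← integral_indicator measurableSet_ball]
    exact (integral_sub_left_eq_self ((ball 0 η).indicator (majK d)) volume z).symm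
  rw [field, fieldT, ← integral_sub (h.integrable_smul_gradK hd z)
    (h.integrable_smul_gradT hd η z), e, ← integral_const_mul]
  refine norm_integral_le_of_norm_le ?_ (Eventually.of_forall fun y => ?_)
  · exact (((integrable_majK hd).indicator measurableSet_ball).comp_sub_left z).const_mul _
  · rw [← smul_sub, norm_smul, Real.norm_eq_abs]
    by_cases hy : ‖z - y‖ < η
    · rw [gradT, if_neg (not_le.2 hy), sub_zero, Set.indicator_of_mem (by simpa using hy),
        norm_gradK hd]
      have h2 := inv_pow_le_majK_of_le_one (hy.le.trans hη1)
      calc |μ y| * (kapC d * (‖z - y‖ ^ (d - 1))⁻¹) ≤ M * (kapC d * (2 ^ d * majK d (z - y))) := by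
            gcongr
            exact h.abs_le y
        _ = _ := by ring
    · rw [gradT, if_pos (not_lt.1 hy), sub_self, norm_zero, mul_zero,
        Set.indicator_of_notMem (by simpa using hy), mul_zero]

lemma tendsto_integral_ball_majK (hd : 2 ≤ d) :
    Tendsto (fun η => ∫ u in ball (0 : Euc d) η, majK d u) (𝓝[>] 0) (𝓝 0) := by
  exact (integrable_majK hd).tendsto_setIntegral_nhds_zero (tendsto_volume_ball hd 0)

lemma hasGradientAt_pot (hd : 2 ≤ d) (h : BddDensity μ M R) (z : Euc d) :
    HasGradientAt (pot d μ) (field d μ z) z := by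
  rw [hasGradientAt_iff_hasFDerivAt]
  have hη : ∀ n : ℕ, (0 : ℝ) < 1 / ((n : ℝ) + 1) := fun n => by positivity
  have hη1 : ∀ n : ℕ, 1 / ((n : ℝ) + 1) ≤ 1 := fun n => by
    rw [div_le_one (by positivity)]; linarith [n.cast_nonneg (α := ℝ)]
  have hlim : Tendsto (fun n : ℕ => 1 / ((n : ℝ) + 1)) atTop (𝓝[>] 0) :=
    tendsto_nhdsWithin_iff.2 ⟨tendsto_one_div_add_atTop_nhds_zero_nat, Eventually.of_forall hη⟩
  refine hasFDerivAt_of_tendstoUniformly (l := atTop)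
    (f := fun n : ℕ => potT d (1 / ((n : ℝ) + 1)) μ)
    (f' := fun n z => InnerProductSpace.toDual ℝ (Euc d) (fieldT d (1 / ((n : ℝ) + 1)) μ z))
    (g' := fun z => InnerProductSpace.toDual ℝ (Euc d) (field d μ z)) ?_
    (fun n z => h.hasFDerivAt_potT hd (hη n) z) (fun z => (h.tendsto_potT hd z).comp hlim) z
  rw [Metric.tendstoUniformly_iff]
  intro ε hε
  have h1 := ((tendsto_integral_ball_majK hd).comp hlim).const_mul (kapC d * M * 2 ^ d)
  rw [mul_zero] at h1
  filter_upwards [h1.eventually_lt_const hε] with n hn z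
  rw [LinearIsometryEquiv.dist_map, dist_eq_norm]
  exact (h.norm_field_sub_fieldT_le hd (hη1 n) z).trans_lt hn

end BddDensity

lemma polar_aux {d : ℕ} (F : Euc d → ℝ) (x : ({(0)}ᶜ : Set (Euc d))) :
    F ((homeomorphUnitSphereProd (Euc d) x).2.1 • (homeomorphUnitSphereProd (Euc d) x).1.1)
      = F x.1 := by
  have hx : ‖x.1‖ ≠ 0 := norm_ne_zero_iff.2 x.2
  simp [smul_smul, hx]

lemma integrable_polar {d : ℕ} {F : Euc d → ℝ} (hF : Integrable F) :
    Integrable (fun p : sphere (0 : Euc d) 1 × Set.Ioi (0 : ℝ) => F (p.2.1 • p.1.1))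
      ((volume : Measure (Euc d)).toSphere.prod (Measure.volumeIoiPow (d - 1))) := by
  have h := (volume : Measure (Euc d)).measurePreserving_homeomorphUnitSphereProd
  rw [finrank_euclideanSpace_fin] at h
  rw [← h.integrable_comp_emb (Homeomorph.measurableEmbedding _)]
  have e : (fun p : sphere (0 : Euc d) 1 × Set.Ioi (0 : ℝ) => F (p.2.1 • p.1.1)) ∘
      (homeomorphUnitSphereProd (Euc d)) = F ∘ Subtype.val := funext fun x => polar_aux F x
  rw [e]
  exact (integrableOn_iff_comap_subtypeVal (measurableSet_singleton _).compl).1 hF.integrableOn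

lemma integral_polar {d : ℕ} (hd : 2 ≤ d) {F : Euc d → ℝ} (hF : Integrable F) :
    ∫ u, F u = ∫ ω, (∫ r : Set.Ioi (0 : ℝ), F (r.1 • ω.1) ∂(Measure.volumeIoiPow (d - 1)))
      ∂(volume : Measure (Euc d)).toSphere := by
  have : Nonempty (Fin d) := ⟨⟨0, by omega⟩⟩
  have h := (volume : Measure (Euc d)).measurePreserving_homeomorphUnitSphereProd
  rw [finrank_euclideanSpace_fin] at h
  rw [← integral_prod _ (integrable_polar hF),
    ← h.integral_comp (Homeomorph.measurableEmbedding _)]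
  simp only [polar_aux]
  rw [integral_subtype_comap (measurableSet_singleton _).compl F, restrict_compl_singleton]

lemma integral_volumeIoiPow (m : ℕ) (f : ℝ → ℝ) :
    ∫ r : Set.Ioi (0 : ℝ), f r.1 ∂(Measure.volumeIoiPow m)
      = ∫ r in Set.Ioi (0 : ℝ), r ^ m * f r := by
  simp only [Measure.volumeIoiPow, ENNReal.ofReal]
  rw [integral_withDensity_eq_integral_smul,
    integral_subtype_comap measurableSet_Ioi fun a ↦ Real.toNNReal (a ^ m) • f a,
    setIntegral_congr_fun measurableSet_Ioi fun x hx ↦ ?_]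
  · rw [NNReal.smul_def, Real.coe_toNNReal _ (pow_nonneg (le_of_lt hx) _), smul_eq_mul]
  · exact (measurable_subtype_coe.pow_const _).real_toNNReal

lemma integrable_volumeIoiPow {m : ℕ} {f : ℝ → ℝ}
    (hf : Integrable (fun r : Set.Ioi (0 : ℝ) => f r.1) (Measure.volumeIoiPow m)) :
    IntegrableOn (fun r => r ^ m * f r) (Set.Ioi 0) := by
  rw [Measure.volumeIoiPow, integrable_withDensity_iff_integrable_smul' (by fun_prop)
    (by simp)] at hf
  rw [integrableOn_iff_comap_subtypeVal measurableSet_Ioi]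
  refine hf.congr (Eventually.of_forall fun x => ?_)
  have hx : 0 < x.1 := x.2
  simp [ENNReal.toReal_ofReal (pow_nonneg hx.le m)]

/-- The fundamental theorem of calculus on a half-line, off a countable set. -/
lemma integral_Ioi_of_hasDerivAt_off_countable {f f' : ℝ → ℝ} (hf : Continuous f)
    {s : Set ℝ} (hs : s.Countable) (hd : ∀ r, 0 < r → r ∉ s → HasDerivAt f (f' r) r)
    (hi : IntegrableOn f' (Set.Ioi 0)) (hlim : Tendsto f atTop (𝓝 0)) :
    ∫ r in Set.Ioi (0 : ℝ), f' r = -f 0 := by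
  have h1 := intervalIntegral_tendsto_integral_Ioi 0 hi tendsto_id
  have h2 : Tendsto (fun b => f b - f 0) atTop (𝓝 (0 - f 0)) := hlim.sub_const _
  rw [zero_sub] at h2
  refine tendsto_nhds_unique h1 (h2.congr' ?_)
  filter_upwards [eventually_ge_atTop 0] with b hb
  refine (integral_eq_of_hasDerivAt_off_countable_of_le f f' hb hs hf.continuousOn
    (fun r hr => hd r hr.1.1 hr.2) ?_).symm
  rw [intervalIntegrable_iff_integrableOn_Ioc_of_le hb]
  exact hi.mono_set Set.Ioc_subset_Ioi_self

/-- The Coulomb kernel is, up to the factor `c_d`, a fundamental solution of the Laplacian. -/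
lemma integral_inner_gradK {d : ℕ} (hd : 2 ≤ d) {φ : Euc d → ℝ} {g : Euc d → Euc d} (a : Euc d)
    (hφ : Continuous φ)
    (hlim : ∀ ω : Euc d, ‖ω‖ = 1 → Tendsto (fun r : ℝ => φ (a + r • ω)) atTop (𝓝 0))
    (hder : ∀ ω : Euc d, ‖ω‖ = 1 → ∃ s : Set ℝ, s.Countable ∧
      ∀ r : ℝ, r ∉ s → HasGradientAt φ (g (a + r • ω)) (a + r • ω))
    (hint : Integrable fun z => inner ℝ (gradK d (z - a)) (g z)) :
    ∫ z, inner ℝ (gradK d (z - a)) (g z) = cConst d * φ a := by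
  have hk := kapC_pos hd
  set F : Euc d → ℝ := fun u => inner ℝ (gradK d u) (g (a + u)) with hF
  have e1 : (fun u => (fun z => inner ℝ (gradK d (z - a)) (g z)) (a + u)) = F := by
    ext u; simp [F]
  have hFi : Integrable F := by
    rw [← e1]; exact hint.comp_add_left a
  rw [← integral_add_left_eq_self _ a, show (∫ u, inner ℝ (gradK d (a + u - a)) (g (a + u)))
    = ∫ u, F u from congrArg (fun f => ∫ u, f u) e1, integral_polar hd hFi]
  have hpt : ∀ ω : Euc d, ‖ω‖ = 1 → ∀ r : ℝ, 0 < r →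
      r ^ (d - 1) * F (r • ω) = -kapC d * inner ℝ (g (a + r • ω)) ω := by
    intro ω hω r hr
    obtain ⟨m, rfl⟩ : ∃ m, d = m + 1 := ⟨d - 1, by omega⟩
    simp only [F, gradK, Nat.add_sub_cancel, norm_smul, hω, mul_one, Real.norm_of_nonneg hr.le,
      inner_smul_left, real_inner_comm ω]
    simp
    field_simp
    ring
  have key : ∀ᵐ ω ∂(volume : Measure (Euc d)).toSphere,
      ∫ r : Set.Ioi (0 : ℝ), F (r.1 • ω.1) ∂(Measure.volumeIoiPow (d - 1)) = kapC d * φ a := by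
    filter_upwards [(integrable_polar hFi).prod_right_ae] with ω hω
    have hω1 : ‖ω.1‖ = 1 := by simp
    have hi := integrable_volumeIoiPow (f := fun r => F (r • ω.1)) hω
    rw [integral_volumeIoiPow _ (fun r => F (r • ω.1)),
      setIntegral_congr_fun measurableSet_Ioi fun r hr => hpt ω.1 hω1 r hr, integral_const_mul]
    have hi' : IntegrableOn (fun r => inner ℝ (g (a + r • ω.1)) ω.1) (Set.Ioi (0 : ℝ)) := by
      refine IntegrableOn.congr_fun (Integrable.const_mul hi (-(kapC d)⁻¹)) (fun r hr => ?_)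
        measurableSet_Ioi
      rw [hpt ω.1 hω1 r hr]
      field_simp
    obtain ⟨s, hs, hs'⟩ := hder ω.1 hω1
    rw [integral_Ioi_of_hasDerivAt_off_countable (f := fun r => φ (a + r • ω.1)) (by fun_prop) hs
      (fun r _ hr => ?_) hi' (hlim ω.1 hω1)]
    · simp
    · have h1 := (hs' r hr).hasFDerivAt
      have h2 : HasDerivAt (fun r : ℝ => a + r • ω.1) ω.1 r := by
        simpa using ((hasDerivAt_id r).smul_const ω.1).const_add a
      exact (h1.comp_hasDerivAt r h2).congr_deriv (by simp)
  rw [integral_congr_ae key, integral_const, Measure.toSphere_real_apply_univ,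
    finrank_euclideanSpace_fin, cConst_eq hd, smul_eq_mul, measureReal_def]
  ring

lemma norm_gradK_sub_le {d : ℕ} (hd : 2 ≤ d) {R : ℝ} {z y : Euc d} (hz : z ≠ 0)
    (hR : 2 * R ≤ ‖z‖) (hy : ‖y‖ ≤ R) :
    ‖gradK d (z - y) - gradK d z‖ ≤ kapC d * (R * (1 + d * 4 ^ (d - 1))) * (‖z‖ ^ d)⁻¹ := by
  have hk := kapC_pos hd
  set v := z - y with hv
  have hzp : 0 < ‖z‖ := norm_pos_iff.2 hz
  have hR0 : 0 ≤ R := (norm_nonneg y).trans hy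
  have hv1 : ‖z‖ / 2 ≤ ‖v‖ := by
    have := norm_sub_norm_le z y
    linarith
  have hv2 : ‖v‖ ≤ 2 * ‖z‖ := by
    have := norm_sub_le z y
    linarith
  have hvp : 0 < ‖v‖ := by linarith
  obtain ⟨m, rfl⟩ : ∃ m, d = m + 1 := ⟨d - 1, by omega⟩
  have e : gradK (m + 1) v - gradK (m + 1) z = kapC (m + 1) •
      ((‖z‖ ^ (m + 1))⁻¹ • y + ((‖z‖ ^ (m + 1))⁻¹ - (‖v‖ ^ (m + 1))⁻¹) • v) := by
    have hy' : y = z - v := by simp [hv]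
    simp only [gradK]
    rw [hy']
    module
  have h1 : |(‖z‖ ^ (m + 1))⁻¹ - (‖v‖ ^ (m + 1))⁻¹| * ‖v‖
      ≤ R * ((m + 1 : ℕ) * 4 ^ m) * (‖z‖ ^ (m + 1))⁻¹ := by
    have h2 : |‖v‖ ^ (m + 1) - ‖z‖ ^ (m + 1)| ≤ R * (m + 1 : ℕ) * (2 * ‖z‖) ^ m := by
      refine (abs_pow_sub_pow_le ..).trans ?_
      rw [abs_norm, abs_norm, Nat.add_sub_cancel]
      have h3 : |‖v‖ - ‖z‖| ≤ R := (abs_norm_sub_norm_le _ _).trans (by simpa [hv] using hy)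
      have h4 : max ‖v‖ ‖z‖ ≤ 2 * ‖z‖ := max_le hv2 (by linarith)
      gcongr
    have h5 : (‖z‖ ^ (m + 1))⁻¹ - (‖v‖ ^ (m + 1))⁻¹
        = (‖v‖ ^ (m + 1) - ‖z‖ ^ (m + 1)) * ((‖z‖ ^ (m + 1))⁻¹ * (‖v‖ ^ (m + 1))⁻¹) := by
      field_simp
    rw [h5, abs_mul, abs_of_nonneg (by positivity : 0 ≤ (‖z‖ ^ (m + 1))⁻¹ * (‖v‖ ^ (m + 1))⁻¹)]
    have h6 : (2 * ‖z‖) ^ m * (‖v‖ ^ m)⁻¹ ≤ 4 ^ m := by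
      rw [← div_eq_mul_inv, ← div_pow]
      gcongr
      rw [div_le_iff₀ hvp]
      linarith
    calc _ ≤ R * (m + 1 : ℕ) * (2 * ‖z‖) ^ m * ((‖z‖ ^ (m + 1))⁻¹ * (‖v‖ ^ (m + 1))⁻¹) * ‖v‖ := by
          gcongr
      _ = R * (m + 1 : ℕ) * ((2 * ‖z‖) ^ m * (‖v‖ ^ m)⁻¹) * (‖z‖ ^ (m + 1))⁻¹ := by
          field_simp
          ring
      _ ≤ R * (m + 1 : ℕ) * 4 ^ m * (‖z‖ ^ (m + 1))⁻¹ := by gcongr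
      _ = _ := by ring
  rw [e, norm_smul, Real.norm_of_nonneg hk.le, mul_assoc]
  gcongr
  refine (norm_add_le _ _).trans ?_
  rw [norm_smul, norm_smul, Real.norm_of_nonneg (by positivity), Real.norm_eq_abs,
    Nat.add_sub_cancel]
  calc _ ≤ (‖z‖ ^ (m + 1))⁻¹ * R + R * ((m + 1 : ℕ) * 4 ^ m) * (‖z‖ ^ (m + 1))⁻¹ := by gcongr
    _ = _ := by ring

lemma abs_ck_sub_le {d : ℕ} (hd : 2 ≤ d) {R : ℝ} {z y : Euc d} (hz : 2 ≤ ‖z‖)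
    (hR : 2 * R ≤ ‖z‖) (hy : ‖y‖ ≤ R) :
    |ck d (z - y) - ck d z| ≤ kapC d * (2 * R) * ‖z‖⁻¹ := by
  have hk := kapC_pos hd
  have hR0 : 0 ≤ R := (norm_nonneg y).trans hy
  have hv1 : ‖z‖ / 2 ≤ ‖z - y‖ := by
    have := norm_sub_norm_le z y
    linarith
  rw [ck_eq_ckr, ck_eq_ckr]
  refine (abs_ckr_sub_le hd (by linarith) hv1 (by linarith)).trans ?_
  have h3 : |‖z - y‖ - ‖z‖| ≤ R := (abs_norm_sub_norm_le _ _).trans (by simpa using hy)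
  have h4 : ((‖z‖ / 2) ^ (d - 1))⁻¹ ≤ (‖z‖ / 2)⁻¹ := by
    gcongr
    exact le_self_pow₀ (by linarith) (by omega)
  calc _ ≤ kapC d * (‖z‖ / 2)⁻¹ * R := by gcongr
    _ = _ := by rw [inv_div]; ring

/-- The potential of the point charges (truncated at radius `η`) minus that of the background. -/
def chargePotT (d : ℕ) (η : ℝ) (μ : Euc d → ℝ) {n : ℕ} (p : Fin n → Euc d) (z : Euc d) : ℝ :=
  (∑ i, ckT d η (z - p i)) - pot d μ z

/-- The field of the point charges (truncated at radius `η`) minus that of the background. -/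
def chargeFieldT (d : ℕ) (η : ℝ) (μ : Euc d → ℝ) {n : ℕ} (p : Fin n → Euc d) (z : Euc d) :
    Euc d :=
  (∑ i, gradT d η (z - p i)) - field d μ z

/-- The field of the point charges minus that of the background. -/
def chargeField (d : ℕ) (μ : Euc d → ℝ) {n : ℕ} (p : Fin n → Euc d) (z : Euc d) : Euc d :=
  (∑ i, gradK d (z - p i)) - field d μ z

lemma exists_countable_sphere_ray {d : ℕ} (v ω : Euc d) (hω : ‖ω‖ = 1) (η : ℝ) :
    {r : ℝ | ‖v + r • ω‖ = η}.Countable := by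
  set b : ℝ := inner ℝ v ω
  refine Set.Countable.mono (s₂ := {-b + √(b ^ 2 - (‖v‖ ^ 2 - η ^ 2)),
    -b - √(b ^ 2 - (‖v‖ ^ 2 - η ^ 2))}) (fun r hr => ?_) (Set.toFinite _).countable
  have hr : ‖v + r • ω‖ = η := hr
  have h1 : (r + b) ^ 2 = b ^ 2 - (‖v‖ ^ 2 - η ^ 2) := by
    have := norm_add_sq_real v (r • ω)
    rw [hr, inner_smul_right, norm_smul, hω, mul_one, Real.norm_eq_abs, sq_abs] at this
    linear_combination -this
  have h2 : |r + b| = √(b ^ 2 - (‖v‖ ^ 2 - η ^ 2)) := by rw [← h1, Real.sqrt_sq_eq_abs]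
  rcases abs_choice (r + b) with h | h
  · left; linarith
  · right
    simp only [Set.mem_singleton_iff]
    linarith

namespace BddDensity

variable {d n : ℕ} {μ : Euc d → ℝ} {M R : ℝ} {p : Fin n → Euc d}

lemma exists_norm_field_le (hd : 2 ≤ d) (h : BddDensity μ M R) :
    ∃ B : ℝ, 0 ≤ B ∧ ∀ z, ‖field d μ z‖ ≤ B := by
  have hk := kapC_pos hd
  have hM := h.nonneg
  have hI : 0 ≤ ∫ u, majK d u := integral_nonneg (majK_nonneg d)
  have hJ : 0 ≤ ∫ u, |μ u| := integral_nonneg fun _ => abs_nonneg _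
  refine ⟨kapC d * (M * 2 ^ d * (∫ u, majK d u) + ∫ u, |μ u|), by positivity, fun z => ?_⟩
  have e : ∫ u, majK d u = ∫ y, majK d (z - y) := (integral_sub_left_eq_self (majK d) volume z).symm
  have hi := ((integrable_majK hd).comp_sub_left z).const_mul (M * 2 ^ d)
  rw [field, e, ← integral_const_mul, ← integral_add hi h.integrable.abs, ← integral_const_mul]
  refine norm_integral_le_of_norm_le ((hi.add h.integrable.abs).const_mul _)
    (Eventually.of_forall fun y => ?_)
  rw [norm_smul, norm_gradK hd, Real.norm_eq_abs, mul_left_comm]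
  have h1 := inv_pow_le_majK (z - y)
  have h2 := majK_nonneg d (z - y)
  gcongr
  calc _ ≤ |μ y| * (2 ^ d * majK d (z - y) + 1) := by gcongr
    _ = |μ y| * (2 ^ d * majK d (z - y)) + |μ y| := by ring
    _ ≤ M * (2 ^ d * majK d (z - y)) + |μ y| := by gcongr; exact h.abs_le y
    _ = _ := by ring

lemma norm_neutral_le (h : BddDensity μ M R) (hmass : ∫ y, μ y = n) (hp : ∀ i, ‖p i‖ ≤ R)
    {E : Type*} [NormedAddCommGroup E] [NormedSpace ℝ E] [CompleteSpace E] {f : Euc d → E}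
    {z : Euc d} {δ : ℝ} (hf : ∀ y, ‖y‖ ≤ R → ‖f (z - y) - f z‖ ≤ δ)
    (hi : Integrable fun y => μ y • f (z - y)) :
    ‖(∑ i, f (z - p i)) - ∫ y, μ y • f (z - y)‖ ≤ (n + ∫ y, |μ y|) * δ := by
  have e : (∑ i, f (z - p i)) - ∫ y, μ y • f (z - y)
      = (∑ i, (f (z - p i) - f z)) - ∫ y, μ y • (f (z - y) - f z) := by
    simp only [smul_sub]
    rw [integral_sub hi (h.integrable.smul_const _), integral_smul_const, hmass,
      Finset.sum_sub_distrib]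
    simp [Nat.cast_smul_eq_nsmul]
  rw [e, add_mul]
  refine (norm_sub_le _ _).trans (add_le_add ?_ ?_)
  · refine (norm_sum_le_of_le _ fun i _ => hf _ (hp i)).trans ?_
    simp
  · rw [← integral_mul_const]
    refine norm_integral_le_of_norm_le (h.integrable.abs.mul_const _)
      (Eventually.of_forall fun y => ?_)
    rw [norm_smul, Real.norm_eq_abs]
    rcases lt_or_ge R ‖y‖ with hy | hy
    · simp [h.eq_zero y hy]
    · gcongr
      exact hf y hy

lemma one_le_norm_sub {z y : Euc d} (hz : 2 * R + 2 ≤ ‖z‖) (hR : 1 ≤ R) (hy : ‖y‖ ≤ R) :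
    1 ≤ ‖z - y‖ := by
  have := norm_sub_norm_le z y
  linarith

lemma exists_norm_chargeFieldT_le (hd : 2 ≤ d) (h : BddDensity μ M R) (hmass : ∫ y, μ y = n)
    (hp : ∀ i, ‖p i‖ ≤ R) {η : ℝ} (hη : 0 < η) (hη1 : η ≤ 1) :
    ∃ C : ℝ, 0 ≤ C ∧ ∀ z, ‖chargeFieldT d η μ p z‖ ≤ C * ((1 + ‖z‖) ^ d)⁻¹ := by
  have hk := kapC_pos hd
  have hR := h.one_le
  obtain ⟨B, hB0, hB⟩ := h.exists_norm_field_le hd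
  have hJ : 0 ≤ ∫ u, |μ u| := integral_nonneg fun _ => abs_nonneg _
  set C₁ := (n * (kapC d * (η ^ (d - 1))⁻¹) + B) * (1 + (2 * R + 2)) ^ d with hC₁
  set C₂ := (n + ∫ y, |μ y|) * (kapC d * (R * (1 + d * 4 ^ (d - 1)))) * 2 ^ d with hC₂
  have h1 : 0 ≤ C₁ := by positivity
  have h2 : 0 ≤ C₂ := by positivity
  refine ⟨C₁ + C₂, by positivity, fun z => ?_⟩
  rw [add_mul]
  have hz0 := norm_nonneg z
  rcases lt_or_ge ‖z‖ (2 * R + 2) with hz | hz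
  · have h3 : ‖chargeFieldT d η μ p z‖ ≤ n * (kapC d * (η ^ (d - 1))⁻¹) + B := by
      refine (norm_sub_le _ _).trans (add_le_add ?_ (hB z))
      refine (norm_sum_le_of_le _ fun i _ => norm_gradT_le_of_pos hd hη _).trans ?_
      simp
    have h4 : 1 ≤ (1 + (2 * R + 2)) ^ d * ((1 + ‖z‖) ^ d)⁻¹ := by
      rw [← div_eq_mul_inv, le_div_iff₀ (by positivity), one_mul]
      gcongr
    have h5 : 0 ≤ C₂ * ((1 + ‖z‖) ^ d)⁻¹ := by positivity
    have h6 : ‖chargeFieldT d η μ p z‖ ≤ C₁ * ((1 + ‖z‖) ^ d)⁻¹ := by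
      rw [hC₁, mul_assoc]
      exact h3.trans (le_mul_of_one_le_right (by positivity) h4)
    linarith
  · have hzne : z ≠ 0 := norm_pos_iff.1 (by linarith)
    have e : chargeFieldT d η μ p z = (∑ i, gradK d (z - p i)) - ∫ y, μ y • gradK d (z - y) := by
      unfold chargeFieldT field
      congr 1
      refine Finset.sum_congr rfl fun i _ => ?_
      rw [gradT, if_pos (hη1.trans (one_le_norm_sub hz hR (hp i)))]
    have h3 := h.norm_neutral_le hmass hp (f := gradK d) (z := z)
      (fun y hy => norm_gradK_sub_le hd hzne (by linarith) hy) (h.integrable_smul_gradK hd z)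
    have h4 : (‖z‖ ^ d)⁻¹ ≤ 2 ^ d * ((1 + ‖z‖) ^ d)⁻¹ := by
      have : 0 < ‖z‖ := by linarith
      rw [← div_eq_mul_inv, ← div_pow, ← inv_pow]
      gcongr
      rw [le_div_iff₀ (by positivity), inv_mul_le_iff₀ this]
      linarith
    have h5 : 0 ≤ C₁ * ((1 + ‖z‖) ^ d)⁻¹ := by positivity
    have h6 : ‖chargeFieldT d η μ p z‖ ≤ C₂ * ((1 + ‖z‖) ^ d)⁻¹ := by
      rw [e]
      refine h3.trans ?_
      calc _ ≤ (n + ∫ y, |μ y|) * (kapC d * (R * (1 + d * 4 ^ (d - 1)))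
              * (2 ^ d * ((1 + ‖z‖) ^ d)⁻¹)) := by gcongr
        _ = _ := by rw [hC₂]; ring
    linarith

lemma tendsto_chargePotT_ray (hd : 2 ≤ d) (h : BddDensity μ M R) (hmass : ∫ y, μ y = n)
    (hp : ∀ i, ‖p i‖ ≤ R) {η : ℝ} (hη1 : η ≤ 1) (a ω : Euc d) (hω : ‖ω‖ = 1) :
    Tendsto (fun r : ℝ => chargePotT d η μ p (a + r • ω)) atTop (𝓝 0) := by
  have hR := h.one_le
  have hlim : Tendsto (fun r : ℝ => ‖a + r • ω‖) atTop atTop := by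
    refine tendsto_atTop_mono (fun r => ?_) (tendsto_atTop_add_const_right _ (-‖a‖) tendsto_id)
    have h1 := norm_sub_norm_le (r • ω) (-a)
    rw [norm_neg, sub_neg_eq_add, add_comm (r • ω), norm_smul, hω, mul_one, Real.norm_eq_abs] at h1
    have := le_abs_self r
    simp only [id]
    linarith
  have hb : Tendsto (fun r : ℝ => (n + ∫ y, |μ y|) * (kapC d * (2 * R) * ‖a + r • ω‖⁻¹)) atTop
      (𝓝 ((n + ∫ y, |μ y|) * (kapC d * (2 * R) * 0))) :=
    ((tendsto_inv_atTop_zero.comp hlim).const_mul _).const_mul _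
  rw [mul_zero, mul_zero] at hb
  refine squeeze_zero_norm' ?_ hb
  filter_upwards [hlim.eventually_ge_atTop (2 * R + 2)] with r hr
  set z := a + r • ω
  have e : chargePotT d η μ p z = (∑ i, ck d (z - p i)) - ∫ y, μ y • ck d (z - y) := by
    unfold chargePotT pot
    simp only [smul_eq_mul, mul_comm (μ _)]
    congr 1
    refine Finset.sum_congr rfl fun i _ => ?_
    rw [ckT, max_eq_left (hη1.trans (one_le_norm_sub hr hR (hp i))), ck_eq_ckr]
  rw [e]
  refine h.norm_neutral_le hmass hp (f := ck d) (z := z)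
    (fun y hy => abs_ck_sub_le hd (by linarith) (by linarith) hy) ?_
  simpa only [smul_eq_mul, mul_comm (μ _)] using h.integrable_ck_mul hd z

lemma continuous_pot (hd : 2 ≤ d) (h : BddDensity μ M R) : Continuous (pot d μ) :=
  continuous_iff_continuousAt.2 fun z => (h.hasGradientAt_pot hd z).continuousAt

lemma continuous_chargePotT (hd : 2 ≤ d) (h : BddDensity μ M R) {η : ℝ} (hη : 0 < η) :
    Continuous (chargePotT d η μ p) := by
  have h1 := continuous_ckT hd hη
  have h2 := h.continuous_pot hd
  unfold chargePotT
  fun_prop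

lemma hasGradientAt_chargePotT (hd : 2 ≤ d) (h : BddDensity μ M R) {η : ℝ} (hη : 0 < η)
    {z : Euc d} (hz : ∀ i, ‖z - p i‖ ≠ η) :
    HasGradientAt (chargePotT d η μ p) (chargeFieldT d η μ p z) z := by
  rw [hasGradientAt_iff_hasFDerivAt]
  have h1 := HasFDerivAt.fun_sum (u := Finset.univ) fun i _ =>
    (hasGradientAt_ckT hd hη (hz i)).hasFDerivAt.comp z ((hasFDerivAt_id z).sub_const (p i))
  refine (h1.sub (h.hasGradientAt_pot hd z).hasFDerivAt).congr_fderiv ?_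
  ext v
  simp [chargeFieldT]

lemma measurable_field (h : BddDensity μ M R) : Measurable (field d μ) := by
  unfold field
  refine (StronglyMeasurable.integral_prod_right (f := fun z y => μ y • gradK d (z - y))
    (Measurable.stronglyMeasurable ?_)).measurable
  exact (h.measurable.comp measurable_snd).smul
    ((measurable_gradK d).comp (measurable_fst.sub measurable_snd))

lemma measurable_chargeFieldT (h : BddDensity μ M R) (η : ℝ) :
    Measurable (chargeFieldT d η μ p) :=
  (Finset.measurable_fun_sum _ fun i _ => (measurable_gradT d η).comp (by fun_prop)).sub
    h.measurable_field

lemma measurable_chargeField (h : BddDensity μ M R) :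
    Measurable (chargeField d μ p) :=
  (Finset.measurable_fun_sum _ fun i _ => (measurable_gradK d).comp (by fun_prop)).sub
    h.measurable_field

lemma abs_inner_le_majK (hd : 2 ≤ d) (hR : 0 ≤ R) {C : ℝ} (hC : 0 ≤ C) {z a v : Euc d}
    (ha : ‖a‖ ≤ R) (hv : ‖v‖ ≤ C * ((1 + ‖z‖) ^ d)⁻¹) :
    |inner ℝ (gradK d (z - a)) v| ≤ kapC d * C * (1 + R) ^ d * majK d (z - a) := by
  have hk := kapC_pos hd
  refine (abs_real_inner_le_norm _ _).trans ?_
  have h1 : ((1 + ‖z‖) ^ d)⁻¹ ≤ (1 + R) ^ d * ((1 + ‖z - a‖) ^ d)⁻¹ := by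
    rw [← div_eq_mul_inv, ← div_pow, ← inv_pow]
    gcongr
    rw [le_div_iff₀ (by positivity), inv_mul_le_iff₀ (by positivity)]
    have := norm_sub_le z a
    nlinarith [norm_nonneg z]
  rw [norm_gradK hd, majK]
  calc _ ≤ kapC d * (‖z - a‖ ^ (d - 1))⁻¹ * (C * ((1 + R) ^ d * ((1 + ‖z - a‖) ^ d)⁻¹)) := by
        gcongr
        exact hv.trans (by gcongr)
    _ = _ := by ring

lemma integrable_inner_gradK (hd : 2 ≤ d) (h : BddDensity μ M R) (hmass : ∫ y, μ y = n)
    (hp : ∀ i, ‖p i‖ ≤ R) {η : ℝ} (hη : 0 < η) (hη1 : η ≤ 1) (a : Euc d) :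
    Integrable fun z => inner ℝ (gradK d (z - a)) (chargeFieldT d η μ p z) := by
  obtain ⟨C, hC0, hC⟩ := h.exists_norm_chargeFieldT_le hd hmass hp hη hη1
  refine (((integrable_majK hd).comp_sub_right a).const_mul
    (kapC d * C * (1 + ‖a‖) ^ d)).mono' ?_
    (Eventually.of_forall fun z => abs_inner_le_majK hd (norm_nonneg a) hC0 le_rfl (hC z))
  exact (((measurable_gradK d).comp (by fun_prop)).inner
    (h.measurable_chargeFieldT η)).aestronglyMeasurable

lemma integral_inner_gradK_chargeFieldT (hd : 2 ≤ d) (h : BddDensity μ M R)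
    (hmass : ∫ y, μ y = n) (hp : ∀ i, ‖p i‖ ≤ R) {η : ℝ} (hη : 0 < η) (hη1 : η ≤ 1) (a : Euc d) :
    ∫ z, inner ℝ (gradK d (z - a)) (chargeFieldT d η μ p z)
      = cConst d * chargePotT d η μ p a := by
  refine integral_inner_gradK hd a (h.continuous_chargePotT hd hη)
    (fun ω hω => h.tendsto_chargePotT_ray hd hmass hp hη1 a ω hω) (fun ω hω => ?_)
    (h.integrable_inner_gradK hd hmass hp hη hη1 a)
  refine ⟨⋃ i, {r : ℝ | ‖(a - p i) + r • ω‖ = η},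
    Set.countable_iUnion fun i => exists_countable_sphere_ray _ _ hω η, fun r hr => ?_⟩
  refine h.hasGradientAt_chargePotT hd hη fun i hi => hr (Set.mem_iUnion.2 ⟨i, ?_⟩)
  have : a - p i + r • ω = a + r • ω - p i := by abel
  rw [Set.mem_ofPred_eq, this, hi]

lemma integrable_prod_inner (hd : 2 ≤ d) (h : BddDensity μ M R) (hmass : ∫ y, μ y = n)
    (hp : ∀ i, ‖p i‖ ≤ R) {η : ℝ} (hη : 0 < η) (hη1 : η ≤ 1) :
    Integrable (fun q : Euc d × Euc d =>
      μ q.2 * inner ℝ (gradK d (q.1 - q.2)) (chargeFieldT d η μ p q.1))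
      ((volume : Measure (Euc d)).prod volume) := by
  obtain ⟨C, hC0, hC⟩ := h.exists_norm_chargeFieldT_le hd hmass hp hη hη1
  have h1 := Integrable.convolution_integrand (ContinuousLinearMap.mul ℝ ℝ) h.integrable.abs
    (integrable_majK hd)
  refine (h1.const_mul (kapC d * C * (1 + R) ^ d)).mono' ?_ (Eventually.of_forall fun q => ?_)
  · exact ((h.measurable.comp measurable_snd).mul (((measurable_gradK d).comp
      (measurable_fst.sub measurable_snd)).inner
        ((h.measurable_chargeFieldT η).comp measurable_fst))).aestronglyMeasurable
  · rw [norm_mul, Real.norm_eq_abs, Real.norm_eq_abs]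
    simp only [ContinuousLinearMap.mul_apply']
    rcases lt_or_ge R ‖q.2‖ with hy | hy
    · simp [h.eq_zero _ hy]
    · have := abs_inner_le_majK hd (zero_le_one.trans h.one_le) hC0 hy (hC q.1)
      calc _ ≤ |μ q.2| * (kapC d * C * (1 + R) ^ d * majK d (q.1 - q.2)) := by gcongr
        _ = _ := by ring

lemma integral_inner_field (hd : 2 ≤ d) (h : BddDensity μ M R) (hmass : ∫ y, μ y = n)
    (hp : ∀ i, ‖p i‖ ≤ R) {η : ℝ} (hη : 0 < η) (hη1 : η ≤ 1) :
    (Integrable fun z => inner ℝ (field d μ z) (chargeFieldT d η μ p z)) ∧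
    ∫ z, inner ℝ (field d μ z) (chargeFieldT d η μ p z)
      = cConst d * ∫ y, chargePotT d η μ p y * μ y := by
  have hi := h.integrable_prod_inner hd hmass hp hη hη1
  have e : ∀ z, inner ℝ (field d μ z) (chargeFieldT d η μ p z)
      = ∫ y, μ y * inner ℝ (gradK d (z - y)) (chargeFieldT d η μ p z) := fun z => by
    rw [field, real_inner_comm, ← integral_inner (h.integrable_smul_gradK hd z)]
    simp only [inner_smul_right, real_inner_comm]
  simp only [e]
  refine ⟨hi.integral_prod_left, ?_⟩
  rw [integral_integral_swap hi, ← integral_const_mul]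
  refine integral_congr_ae (Eventually.of_forall fun y => ?_)
  simp only
  rw [integral_const_mul, h.integral_inner_gradK_chargeFieldT hd hmass hp hη hη1]
  ring

lemma integral_inner_chargeField (hd : 2 ≤ d) (h : BddDensity μ M R) (hmass : ∫ y, μ y = n)
    (hp : ∀ i, ‖p i‖ ≤ R) {η : ℝ} (hη : 0 < η) (hη1 : η ≤ 1) :
    (Integrable fun z => inner ℝ (chargeField d μ p z) (chargeFieldT d η μ p z)) ∧
    ∫ z, inner ℝ (chargeField d μ p z) (chargeFieldT d η μ p z)
      = cConst d * ((∑ i, chargePotT d η μ p (p i)) - ∫ y, chargePotT d η μ p y * μ y) := by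
  obtain ⟨h1, h2⟩ := h.integral_inner_field hd hmass hp hη hη1
  have h3 := integrable_finsetSum Finset.univ fun i _ =>
    h.integrable_inner_gradK hd hmass hp hη hη1 (p i)
  have e : ∀ z, inner ℝ (chargeField d μ p z) (chargeFieldT d η μ p z)
      = (∑ i, inner ℝ (gradK d (z - p i)) (chargeFieldT d η μ p z))
        - inner ℝ (field d μ z) (chargeFieldT d η μ p z) := fun z => by
    rw [chargeField, inner_sub_left, sum_inner]
  simp only [e]
  refine ⟨h3.sub h1, ?_⟩
  rw [integral_sub h3 h1, integral_finsetSum _ fun i _ =>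
    h.integrable_inner_gradK hd hmass hp hη hη1 (p i), h2, mul_sub, Finset.mul_sum]
  simp only [h.integral_inner_gradK_chargeFieldT hd hmass hp hη hη1]

end BddDensity

/-- The untruncated potential of the point charges and the background. -/
def chargePot (d : ℕ) (μ : Euc d → ℝ) {n : ℕ} (p : Fin n → Euc d) (z : Euc d) : ℝ :=
  (∑ i, ck d (z - p i)) - pot d μ z

lemma exists_pos_separation {d n : ℕ} {p : Fin n → Euc d} (hp : Function.Injective p) :
    ∃ δ : ℝ, 0 < δ ∧ δ ≤ 1 ∧ ∀ i j, i ≠ j → 2 * δ ≤ ‖p i - p j‖ := by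
  have h : ∀ᶠ δ in 𝓝[>] (0 : ℝ), ∀ i j, i ≠ j → 2 * δ ≤ ‖p i - p j‖ := by
    refine eventually_all.2 fun i => eventually_all.2 fun j => ?_
    by_cases hij : i = j
    · simp [hij]
    · have hpos : 0 < ‖p i - p j‖ := norm_pos_iff.2 (sub_ne_zero.2 fun e => hij (hp e))
      filter_upwards [Ioo_mem_nhdsGT (half_pos hpos)] with δ hδ _
      linarith [hδ.2]
  obtain ⟨δ, h1, h2⟩ := (h.and (Ioo_mem_nhdsGT one_pos)).exists
  exact ⟨δ, h2.1, h2.2.le, h1⟩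

namespace BddDensity

variable {d n : ℕ} {μ : Euc d → ℝ} {M R : ℝ} {p : Fin n → Euc d}

lemma hasGradientAt_chargePot (hd : 2 ≤ d) (h : BddDensity μ M R) {z : Euc d}
    (hz : ∀ i, z - p i ≠ 0) :
    HasGradientAt (chargePot d μ p) (chargeField d μ p z) z := by
  rw [hasGradientAt_iff_hasFDerivAt]
  have h1 := HasFDerivAt.fun_sum (u := Finset.univ) fun i _ =>
    (hasGradientAt_ck hd (hz i)).hasFDerivAt.comp z ((hasFDerivAt_id z).sub_const (p i))
  refine (h1.sub (h.hasGradientAt_pot hd z).hasFDerivAt).congr_fderiv ?_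
  ext v
  simp [chargeField]

lemma exists_norm_chargeFieldT_le_near (hd : 2 ≤ d) (h : BddDensity μ M R)
    {δ : ℝ} (hδ : 0 < δ) (hsep : ∀ i j, i ≠ j → 2 * δ ≤ ‖p i - p j‖) :
    ∃ C : ℝ, ∀ η, η ≤ δ → ∀ z ∈ ⋃ i, ball (p i) η, ‖chargeFieldT d η μ p z‖ ≤ C := by
  obtain ⟨B, hB0, hB⟩ := h.exists_norm_field_le hd
  refine ⟨(∑ _i : Fin n, kapC d * (δ ^ (d - 1))⁻¹) + B, fun η hη z hz => ?_⟩
  obtain ⟨i, hi⟩ := Set.mem_iUnion.1 hz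
  rw [mem_ball, dist_eq_norm] at hi
  refine (norm_sub_le _ _).trans (add_le_add ((norm_sum_le _ _).trans ?_) (hB z))
  refine Finset.sum_le_sum fun j _ => ?_
  have hk := kapC_pos hd
  by_cases hij : i = j
  · subst hij
    rw [gradT, if_neg (not_le.2 hi), norm_zero]
    positivity
  · have h1 : δ ≤ ‖z - p j‖ := by
      have := norm_sub_le_norm_sub_add_norm_sub (p i) z (p j)
      have := hsep i j hij
      rw [norm_sub_rev z (p i)] at hi
      linarith
    refine (norm_gradT_le hd η _).trans ?_
    gcongr

lemma integrableOn_norm_chargeField (hd : 2 ≤ d) (h : BddDensity μ M R) (r : ℝ) :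
    IntegrableOn (fun z => ‖chargeField d μ p z‖) (ball 0 r) := by
  obtain ⟨B, hB0, hB⟩ := h.exists_norm_field_le hd
  have hk := kapC_pos hd
  have h1 : IntegrableOn (fun z => (∑ i, kapC d * (2 ^ d * majK d (z - p i) + 1)) + B)
      (ball 0 r) := by
    have hc : ∀ c : ℝ, IntegrableOn (fun _ : Euc d => c) (ball 0 r) := fun c =>
      integrableOn_const measure_ball_lt_top.ne
    refine Integrable.add (integrable_finsetSum _ fun i _ => ?_) (hc B)
    exact (((((integrable_majK hd).comp_sub_right (p i)).integrableOn).const_mul _).add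
      (hc 1)).const_mul _
  refine h1.mono' h.measurable_chargeField.norm.aestronglyMeasurable
    (Eventually.of_forall fun z => ?_)
  rw [norm_norm]
  refine (norm_sub_le _ _).trans (add_le_add ((norm_sum_le _ _).trans ?_) (hB z))
  refine Finset.sum_le_sum fun i _ => ?_
  rw [norm_gradK hd]
  gcongr
  exact inv_pow_le_majK _

lemma tendsto_setIntegral_inner_chargeField (hd : 2 ≤ d) (h : BddDensity μ M R)
    (hp : ∀ i, ‖p i‖ ≤ R) (hinj : Function.Injective p) :
    Tendsto (fun η => ∫ z in ⋃ i, ball (p i) η,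
      inner ℝ (chargeField d μ p z) (chargeFieldT d η μ p z)) (𝓝[>] 0) (𝓝 0) := by
  obtain ⟨δ, hδ, hδ1, hsep⟩ := exists_pos_separation hinj
  obtain ⟨C, hC⟩ := h.exists_norm_chargeFieldT_le_near hd hδ hsep
  have hI := h.integrableOn_norm_chargeField (p := p) hd (R + 1)
  have hvol : Tendsto (fun η => volume (⋃ i, ball (p i) η)) (𝓝[>] 0) (𝓝 0) := by
    have hs : Tendsto (fun η => ∑ i, volume (ball (p i) η)) (𝓝[>] (0 : ℝ)) (𝓝 0) := by
      simpa using tendsto_finsetSum Finset.univ fun i _ => tendsto_volume_ball hd (p i)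
    exact tendsto_of_tendsto_of_tendsto_of_le_of_le tendsto_const_nhds hs (fun _ => zero_le)
      fun η => measure_iUnion_fintype_le _ _
  have hvol' : Tendsto (fun η => (volume.restrict (ball (0 : Euc d) (R + 1)))
      (⋃ i, ball (p i) η)) (𝓝[>] 0) (𝓝 0) :=
    tendsto_of_tendsto_of_tendsto_of_le_of_le tendsto_const_nhds hvol (fun _ => zero_le)
      fun η => Measure.restrict_apply_le _ _
  have hlim := (hI.tendsto_setIntegral_nhds_zero hvol').const_mul C
  rw [mul_zero] at hlim
  refine squeeze_zero_norm' ?_ hlim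
  filter_upwards [Ioo_mem_nhdsGT hδ] with η hη
  have hsub : (⋃ i, ball (p i) η) ⊆ ball (0 : Euc d) (R + 1) := by
    refine Set.iUnion_subset fun i z hz => ?_
    rw [mem_ball, dist_eq_norm] at hz
    rw [mem_ball_zero_iff]
    have := norm_sub_norm_le z (p i)
    linarith [hp i, hη.2]
  have hm : MeasurableSet (⋃ i, ball (p i) η) := MeasurableSet.iUnion fun i => measurableSet_ball
  rw [Measure.restrict_restrict hm, Set.inter_eq_left.2 hsub, ← integral_const_mul]
  refine norm_integral_le_of_norm_le ((hI.mono_set hsub).const_mul C) ?_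
  filter_upwards [ae_restrict_mem hm] with z hz
  refine (norm_inner_le_norm _ _).trans ?_
  rw [mul_comm]
  gcongr
  exact hC η hη.2.le z hz

lemma integrable_continuous_mul (h : BddDensity μ M R) {f : Euc d → ℝ} (hf : Continuous f) :
    Integrable fun y => f y * μ y := by
  obtain ⟨C, hC⟩ := (isCompact_closedBall (0 : Euc d) R).exists_bound_of_continuousOn
    hf.continuousOn
  refine (h.integrable.abs.const_mul C).mono' (hf.measurable.mul h.measurable).aestronglyMeasurable
    (Eventually.of_forall fun y => ?_)
  rw [norm_mul, Real.norm_eq_abs (μ y)]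
  rcases lt_or_ge R ‖y‖ with hy | hy
  · simp [h.eq_zero y hy]
  · gcongr
    exact hC y (mem_closedBall_zero_iff.2 hy)

lemma integral_chargePotT_mul (hd : 2 ≤ d) (h : BddDensity μ M R) {η : ℝ} (hη : 0 < η) :
    ∫ y, chargePotT d η μ p y * μ y
      = (∑ i, potT d η μ (p i)) - ∫ y, pot d μ y * μ y := by
  have h1 : ∀ i, Integrable fun y => ckT d η (y - p i) * μ y := fun i =>
    h.integrable_continuous_mul ((continuous_ckT hd hη).comp (by fun_prop))
  simp only [chargePotT, sub_mul, Finset.sum_mul]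
  rw [integral_sub (integrable_finsetSum _ fun i _ => h1 i)
    (h.integrable_continuous_mul (h.continuous_pot hd)), integral_finsetSum _ fun i _ => h1 i]
  congr 1
  refine Finset.sum_congr rfl fun i _ => ?_
  simp only [potT, ckT, norm_sub_rev]

lemma chargePotT_self {η : ℝ}
    (hsep : ∀ i j, i ≠ j → η ≤ ‖p i - p j‖) (hη : 0 < η) (i : Fin n) :
    chargePotT d η μ p (p i)
      = ckr d η + (∑ j, if i ≠ j then ck d (p i - p j) else 0) - pot d μ (p i) := by
  have e : ∀ j, ckT d η (p i - p j)
      = (if i = j then ckr d η else 0) + (if i ≠ j then ck d (p i - p j) else 0) := fun j => by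
    by_cases hij : i = j
    · subst hij
      simp [ckT, hη.le]
    · simp [hij, ckT, hsep i j hij, ck_eq_ckr]
  simp [chargePotT, e, Finset.sum_add_distrib]

/-- The renormalized energy of point charges in a neutralizing bounded background. -/
theorem tendsto_renormalized_energy (hd : 2 ≤ d) (h : BddDensity μ M R)
    (hmass : ∫ y, μ y = n) (hp : ∀ i, ‖p i‖ ≤ R) (hinj : Function.Injective p) :
    Tendsto (fun η => (∫ z in (⋃ i, ball (p i) η)ᶜ, ‖gradient (chargePot d μ p) z‖ ^ 2)
        - n * cConst d * ckr d η) (𝓝[>] 0)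
      (𝓝 (cConst d * ((∑ i, ∑ j, if i ≠ j then ck d (p i - p j) else 0)
        - 2 * (∑ i, pot d μ (p i)) + ∫ y, pot d μ y * μ y))) := by
  obtain ⟨δ, hδ, hδ1, hsep⟩ := exists_pos_separation hinj
  have h1 := h.tendsto_setIntegral_inner_chargeField hd hp hinj
  have h2 := tendsto_finsetSum Finset.univ fun i _ => h.tendsto_potT hd (p i)
  have h3 := (((tendsto_const_nhds (x := (∑ i, ∑ j, if i ≠ j then ck d (p i - p j) else 0)
    - (∑ i, pot d μ (p i)) + ∫ y, pot d μ y * μ y)).sub h2).const_mul (cConst d)).sub h1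
  refine (h3.congr' ?_).trans_eq ?_
  · filter_upwards [Ioo_mem_nhdsGT hδ] with η hη
    obtain ⟨hη0, hηδ⟩ := hη
    have hm : MeasurableSet (⋃ i, ball (p i) η) :=
      MeasurableSet.iUnion fun i => measurableSet_ball
    have e : ∫ z in (⋃ i, ball (p i) η)ᶜ, ‖gradient (chargePot d μ p) z‖ ^ 2
        = ∫ z in (⋃ i, ball (p i) η)ᶜ, inner ℝ (chargeField d μ p z) (chargeFieldT d η μ p z) := by
      refine setIntegral_congr_fun hm.compl fun z hz => ?_
      have hz' : ∀ i, η ≤ ‖z - p i‖ := fun i => by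
        by_contra hlt
        exact hz (Set.mem_iUnion.2 ⟨i, by rwa [mem_ball, dist_eq_norm, ← not_le]⟩)
      have hf : chargeFieldT d η μ p z = chargeField d μ p z := by
        simp only [chargeFieldT, chargeField, gradT, hz', if_true]
      rw [(h.hasGradientAt_chargePot hd fun i =>
        norm_pos_iff.1 (hη0.trans_le (hz' i))).gradient, hf, real_inner_self_eq_norm_sq]
    obtain ⟨hi, hv⟩ := h.integral_inner_chargeField hd hmass hp hη0 (hηδ.le.trans hδ1)
    have hadd := integral_add_compl hm hi
    rw [e, ← sub_eq_of_eq_add' hadd.symm, hv, h.integral_chargePotT_mul hd hη0]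
    simp only [chargePotT_self (fun i j hij => by linarith [hsep i j hij]) hη0]
    simp only [Finset.sum_sub_distrib, Finset.sum_add_distrib, Finset.sum_const,
      Finset.card_univ, Fintype.card_fin, nsmul_eq_mul]
    ring
  · congr 1
    ring

end BddDensity

lemma ck_smul {d : ℕ} (hd : 2 ≤ d) {s : ℝ} (hs : 0 < s) {u : Euc d} (hu : u ≠ 0) :
    ck d (s • u) = (s ^ (d - 2))⁻¹ * ck d u - if d = 2 then Real.log s else 0 := by
  have hn : ‖u‖ ≠ 0 := norm_ne_zero_iff.2 hu
  rw [ck_eq_ckr, ck_eq_ckr, norm_smul, Real.norm_of_nonneg hs.le]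
  by_cases h2 : d = 2
  · subst h2
    simp only [ckr, if_true, Real.log_mul hs.ne' hn]
    norm_num
    ring
  · rw [ckr_eq_of_ne hd h2, ckr_eq_of_ne hd h2, if_neg h2, mul_pow, mul_inv, sub_zero]

lemma integral_comp_inv_smul_euc {d : ℕ} (f : Euc d → ℝ) {s : ℝ} (hs : 0 < s) :
    ∫ y, f (s⁻¹ • y) = s ^ d * ∫ y, f y := by
  rw [Measure.integral_comp_inv_smul, finrank_euclideanSpace_fin, smul_eq_mul,
    abs_of_nonneg (by positivity)]

lemma pot_comp_inv_smul {d : ℕ} (hd : 2 ≤ d) {μ : Euc d → ℝ} {M R : ℝ} (h : BddDensity μ M R)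
    (hmass : ∫ y, μ y = 1) {s : ℝ} (hs : 0 < s) (v : Euc d) :
    pot d (fun y => μ (s⁻¹ • y)) (s • v)
      = s ^ 2 * pot d μ v - s ^ d * if d = 2 then Real.log s else 0 := by
  have : Nontrivial (Euc d) := by
    have : Nonempty (Fin d) := ⟨⟨0, by omega⟩⟩
    infer_instance
  have e1 : pot d (fun y => μ (s⁻¹ • y)) (s • v) = s ^ d * ∫ y, ck d (s • (v - y)) * μ y := by
    rw [← integral_comp_inv_smul_euc _ hs]
    refine integral_congr_ae (Eventually.of_forall fun y => ?_)
    simp only [smul_sub, smul_inv_smul₀ hs.ne']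
  have e2 : ∫ y, ck d (s • (v - y)) * μ y
      = ∫ y, ((s ^ (d - 2))⁻¹ * (ck d (v - y) * μ y)
        - (if d = 2 then Real.log s else 0) * μ y) := by
    refine integral_congr_ae ?_
    filter_upwards [Measure.ae_ne volume v] with y hy
    rw [ck_smul hd hs (sub_ne_zero.2 hy.symm)]
    ring
  rw [e1, e2, integral_sub ((h.integrable_ck_mul hd v).const_mul _) (h.integrable.const_mul _),
    integral_const_mul, integral_const_mul, hmass, mul_one, mul_sub]
  congr 1
  obtain ⟨m, rfl⟩ := Nat.exists_eq_add_of_le hd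
  rw [Nat.add_sub_cancel_left, pow_add, ← mul_assoc, mul_assoc (s ^ 2),
    mul_inv_cancel₀ (by positivity), mul_one, pot]

lemma integral_pot_comp_inv_smul_mul {d : ℕ} (hd : 2 ≤ d) {μ : Euc d → ℝ} {M R : ℝ}
    (h : BddDensity μ M R) (hmass : ∫ y, μ y = 1) {s : ℝ} (hs : 0 < s) :
    ∫ z, pot d (fun y => μ (s⁻¹ • y)) z * μ (s⁻¹ • z)
      = s ^ d * (s ^ 2 * (∫ y, pot d μ y * μ y) - s ^ d * if d = 2 then Real.log s else 0) := by
  have e : ∫ z, pot d (fun y => μ (s⁻¹ • y)) z * μ (s⁻¹ • z)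
      = s ^ d * ∫ y, pot d (fun y => μ (s⁻¹ • y)) (s • y) * μ y := by
    rw [← integral_comp_inv_smul_euc _ hs]
    simp only [smul_inv_smul₀ hs.ne']
  rw [e]
  simp only [pot_comp_inv_smul hd h hmass hs, sub_mul, mul_assoc]
  rw [integral_sub ((h.integrable_continuous_mul (h.continuous_pot hd)).const_mul _)
    ((h.integrable.const_mul _).const_mul _)]
  simp only [integral_const_mul, hmass, mul_one]

lemma coulombPair_self {d : ℕ} {μ : Euc d → ℝ}
    (h : Integrable (fun z : Euc d × Euc d => ck d (z.1 - z.2) * μ z.1 * μ z.2)) :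
    coulombPair d μ μ = ∫ y, pot d μ y * μ y := by
  rw [coulombPair, Measure.volume_eq_prod, integral_prod _ h]
  refine integral_congr_ae (Eventually.of_forall fun y => ?_)
  simp only [pot]
  rw [← integral_mul_const]
  refine integral_congr_ae (Eventually.of_forall fun z => ?_)
  ring

lemma BddDensity.comp_inv_smul {d : ℕ} {μ : Euc d → ℝ} {M R : ℝ} (h : BddDensity μ M R)
    {s R' : ℝ} (hs : 0 < s) (hR' : s * R ≤ R') (h1 : 1 ≤ R') :
    BddDensity (fun y => μ (s⁻¹ • y)) M R' where
  measurable := h.measurable.comp (measurable_const_smul _)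
  abs_le y := h.abs_le _
  eq_zero y hy := h.eq_zero _ <| by
    rw [norm_smul, norm_inv, Real.norm_of_nonneg hs.le, lt_inv_mul_iff₀ hs]
    exact hR'.trans_lt hy
  one_le := h1

lemma exists_bddDensity {d : ℕ} {μ : Euc d → ℝ} (hmeas : Measurable μ) (h0 : ∀ x, 0 ≤ μ x)
    (hbdd : ∃ M : ℝ, ∀ x, μ x ≤ M) (hsupp : HasCompactSupport μ) :
    ∃ M R, BddDensity μ M R := by
  obtain ⟨M, hM⟩ := hbdd
  obtain ⟨R, hR⟩ := hsupp.isCompact.isBounded.subset_closedBall 0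
  refine ⟨M, max R 1, hmeas, fun y => by rw [abs_of_nonneg (h0 y)]; exact hM y, fun y hy => ?_,
    le_max_right _ _⟩
  by_contra hne
  have := mem_closedBall_zero_iff.1 (hR (subset_tsupport _ hne))
  exact absurd hy (not_lt.2 (this.trans (le_max_left _ _)))

/-- **Exact splitting formula.** For `V` continuous, `μ₀` a bounded compactly supported
probability density, and pairwise distinct points `x_1, …, x_n`, the renormalized energy
`W(∇h_n', 1_{ℝ^d}) = lim_{η→0} (∫_{ℝ^d ∖ ⋃ B(x_i',η)} |∇h_n'|² − n c_d w(η))` of the blown-up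
potential exists, and
`H_n(x) = n² E[μ₀] + 2n Σ ζ(x_i) − (1/2)(n log n)·1_{d=2} + n^{1−2/d} c_d^{−1} W(∇h_n', 1_{ℝ^d})`. -/
theorem exact_splitting_formula
    (d : ℕ) (hd : 2 ≤ d)
    (V : Euc d → ℝ) (hV : Continuous V)
    (μ₀ : Euc d → ℝ) (hμmeas : Measurable μ₀) (hμnonneg : ∀ x, 0 ≤ μ₀ x)
    (hμbdd : ∃ M : ℝ, ∀ x, μ₀ x ≤ M) (hμsupp : HasCompactSupport μ₀)
    (hμmass : ∫ x, μ₀ x = 1)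
    -- absolute convergence of the Coulomb interactions involved
    (hDconv : Integrable (fun z : Euc d × Euc d => ck d (z.1 - z.2) * μ₀ z.1 * μ₀ z.2))
    (hVconv : Integrable (fun x => V x * μ₀ x))
    (n : ℕ) (hn : 1 ≤ n)
    (x : Fin n → Euc d) (hx : Function.Injective x) :
    ∃ W : ℝ,
      Tendsto (fun η : ℝ =>
          (∫ z in (⋃ i, ball (((n : ℝ) ^ ((d : ℝ)⁻¹)) • x i) η)ᶜ,
              ‖gradient (blownUpPotential d μ₀ n x) z‖ ^ 2)
            - (n : ℝ) * cConst d * ckr d η)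
        (𝓝[>] 0) (𝓝 W) ∧
      coulombHam d V n x =
        (n : ℝ) ^ 2 * mfEnergy d V μ₀ + 2 * n * ∑ i, zetaFn d V μ₀ (x i)
          - (if d = 2 then (n : ℝ) * Real.log n / 2 else 0)
          + (n : ℝ) ^ ((1 : ℝ) - 2 / d) * (cConst d)⁻¹ * W := by
  obtain ⟨M, R, hμ⟩ := exists_bddDensity hμmeas hμnonneg hμbdd hμsupp
  have hn0 : (0 : ℝ) < n := by exact_mod_cast hn
  have hd0 : (d : ℝ) ≠ 0 := by positivity
  set s : ℝ := (n : ℝ) ^ ((d : ℝ)⁻¹) with hs_def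
  have hs : 0 < s := Real.rpow_pos_of_pos hn0 _
  have hsd : s ^ d = n := by
    rw [hs_def, ← Real.rpow_natCast, ← Real.rpow_mul hn0.le, inv_mul_cancel₀ hd0, Real.rpow_one]
  have hs_inv : (n : ℝ) ^ (-(d : ℝ)⁻¹) = s⁻¹ := Real.rpow_neg hn0.le _
  have hs_pow : (n : ℝ) ^ ((1 : ℝ) - 2 / d) = s ^ (d - 2) := by
    rw [hs_def, ← Real.rpow_natCast, ← Real.rpow_mul hn0.le, Nat.cast_sub hd]
    congr 1
    push_cast
    field_simp
  set p : Fin n → Euc d := fun i => s • x i with hp_def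
  have hinj : Function.Injective p := fun i j hij => hx (smul_right_injective _ hs.ne' hij)
  obtain ⟨B, hB⟩ := (Set.finite_range fun i => ‖p i‖).bddAbove
  have hν := hμ.comp_inv_smul (R' := max (max (s * R) B) 1) hs
    ((le_max_left _ _).trans (le_max_left _ _)) (le_max_right _ _)
  have hpR : ∀ i, ‖p i‖ ≤ max (max (s * R) B) 1 := fun i =>
    (hB ⟨i, rfl⟩).trans ((le_max_right _ _).trans (le_max_left _ _))
  have hmass : ∫ y, μ₀ (s⁻¹ • y) = n := by
    rw [integral_comp_inv_smul_euc _ hs, hμmass, hsd, mul_one]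
  have hpot : blownUpPotential d μ₀ n x = chargePot d (fun y => μ₀ (s⁻¹ • y)) p := by
    funext z
    simp only [blownUpPotential, chargePot, pot, hs_inv, ← hs_def, hp_def]
  refine ⟨_, hpot ▸ hν.tendsto_renormalized_energy hd hmass hpR hinj, ?_⟩
  have hpair : ∀ i j, (if i ≠ j then ck d (p i - p j) else 0)
      = (s ^ (d - 2))⁻¹ * (if i ≠ j then ck d (x i - x j) else 0)
        - ((if d = 2 then Real.log s else 0)
          - if i = j then if d = 2 then Real.log s else 0 else 0) := by
    intro i j
    by_cases hij : i = j
    · simp [hij]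
    · have hu : x i - x j ≠ 0 := sub_ne_zero.2 fun e => hij (hx e)
      simp [hij, hp_def, ← smul_sub, ck_smul hd hs hu]
  have hlog : (if d = 2 then (n : ℝ) * Real.log n / 2 else 0)
      = n * s ^ (d - 2) * if d = 2 then Real.log s else 0 := by
    by_cases h2 : d = 2
    · subst h2
      rw [← hsd]
      simp [Real.log_pow]
      ring
    · simp [h2]
  have hs2 : s ^ 2 = n * (s ^ (d - 2))⁻¹ := by
    rw [← hsd, eq_mul_inv_iff_mul_eq₀ (by positivity), ← pow_add]
    congr 1
    omega
  have hz : ∀ i, zetaFn d V μ₀ (x i)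
      = pot d μ₀ (x i) + V (x i) / 2 - (mfEnergy d V μ₀ + coulombPair d μ₀ μ₀) / 2 := fun i => rfl
  have hc := cConst_pos hd
  have ht : s ^ (d - 2) ≠ 0 := by positivity
  rw [hs_pow, hlog, mul_assoc (s ^ (d - 2)), inv_mul_cancel_left₀ hc.ne']
  simp only [hpair]
  simp only [coulombHam, hz, hp_def, pot_comp_inv_smul hd hμ hμmass hs,
    integral_pot_comp_inv_smul_mul hd hμ hμmass hs, ← coulombPair_self hDconv, hsd, hs2]
  simp only [Finset.sum_add_distrib, Finset.sum_sub_distrib, ← Finset.mul_sum, ← Finset.sum_div,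
    Finset.sum_const, Finset.card_univ, Fintype.card_fin, nsmul_eq_mul, Finset.sum_ite_eq,
    Finset.mem_univ, if_true]
  field_simp
  ring
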